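/- There exists an approval-based committee voting instance in which no fractional committee p satisfies the condition: for every S ⊆ N, ∑_{c ∈ ∪_{i∈S} A_i} p(c) ≥ min(|S|·k/n, |∪_{i∈S} A_i|). Concretely: n = 4 voters, C = {c_1, …, c_5}, k = 4, A_1 = A_2 = {c_1}, A_3 = {c_1, c_2, c_3}, A_4 = {c_1, c_4, c_5}. -/

import Mathlib

open Finset

namespace BWCV

variable {n m : ℕ}

/-- Utility of voter `i` for a fractional committee `p`. -/
def utility (A : Fin n → Finset (Fin m)) (p : Fin m → ℝ) (i : Fin n) : ℝ :=
  ∑ c ∈ A i, p c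

/-- `p` is a fractional committee of size `k`. -/
def IsFractionalCommittee (k : ℕ) (p : Fin m → ℝ) : Prop :=
  (∀ c, 0 ≤ p c ∧ p c ≤ 1) ∧ ∑ c, p c = (k : ℝ)

/-- Group Fair Share. -/
def GFS (k : ℕ) (A : Fin n → Finset (Fin m)) (p : Fin m → ℝ) : Prop :=
  ∀ S : Finset (Fin n),
    (1 / (n : ℝ)) * ∑ i ∈ S, ((min k (A i).card : ℕ) : ℝ) ≤ ∑ c ∈ S.biUnion A, p c

/-- Unanimous Fair Share. -/
def UFS (k : ℕ) (A : Fin n → Finset (Fin m)) (p : Fin m → ℝ) : Prop :=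
  ∀ S : Finset (Fin n), (∀ i ∈ S, ∀ j ∈ S, A i = A j) →
    ∀ i ∈ S, ((S.card : ℝ) / n) * ((min k (A i).card : ℕ) : ℝ) ≤ utility A p i

/-- Strong Unanimous Fair Share. -/
def StrongUFS (k : ℕ) (A : Fin n → Finset (Fin m)) (p : Fin m → ℝ) : Prop :=
  ∀ S : Finset (Fin n), (∀ i ∈ S, ∀ j ∈ S, A i = A j) →
    ∀ i ∈ S, min ((S.card : ℝ) * k / n) ((A i).card : ℝ) ≤ utility A p i

/-- Individual Fair Share. -/
def IFS (k : ℕ) (A : Fin n → Finset (Fin m)) (p : Fin m → ℝ) : Prop :=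
  ∀ i, (1 / (n : ℝ)) * ((min k (A i).card : ℕ) : ℝ) ≤ utility A p i

/-- Strong Individual Fair Share. -/
def StrongIFS (k : ℕ) (A : Fin n → Finset (Fin m)) (p : Fin m → ℝ) : Prop :=
  ∀ i, min ((k : ℝ) / n) ((A i).card : ℝ) ≤ utility A p i

/-- An `ℓ`-cohesive group of voters: `|N'| ≥ ℓ·n/k` and the voters in `N'`
commonly approve at least `ℓ` candidates. -/
def Cohesive (k : ℕ) (A : Fin n → Finset (Fin m)) (ℓ : ℕ) (N' : Finset (Fin n)) : Prop :=
  ((ℓ : ℝ) * n / k ≤ (N'.card : ℝ)) ∧ ℓ ≤ (N'.inf A).card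

/-- Justified Representation. -/
def JR (k : ℕ) (A : Fin n → Finset (Fin m)) (W : Finset (Fin m)) : Prop :=
  ∀ N' : Finset (Fin n), Cohesive k A 1 N' → ∃ i ∈ N', (A i ∩ W).Nonempty

/-- Proportional Justified Representation. -/
def PJR (k : ℕ) (A : Fin n → Finset (Fin m)) (W : Finset (Fin m)) : Prop :=
  ∀ ℓ : ℕ, 0 < ℓ → ∀ N' : Finset (Fin n), Cohesive k A ℓ N' →
    ℓ ≤ ((N'.biUnion A) ∩ W).card

/-- Extended Justified Representation. -/
def EJR (k : ℕ) (A : Fin n → Finset (Fin m)) (W : Finset (Fin m)) : Prop :=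
  ∀ ℓ : ℕ, 0 < ℓ → ∀ N' : Finset (Fin n), Cohesive k A ℓ N' →
    ∃ i ∈ N', ℓ ≤ (A i ∩ W).card

/-- EJR+. -/
def EJRplus (k : ℕ) (A : Fin n → Finset (Fin m)) (W : Finset (Fin m)) : Prop :=
  ¬ ∃ (c : Fin m) (N' : Finset (Fin n)) (ℓ : ℕ), c ∉ W ∧ 0 < ℓ ∧
      ((ℓ : ℝ) * n / k ≤ (N'.card : ℝ)) ∧ (∀ i ∈ N', c ∈ A i) ∧
      (∀ i ∈ N', (A i ∩ W).card < ℓ)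

/-- A weakly `(β, T)`-cohesive group of voters. -/
def WeaklyCohesive (k : ℕ) (A : Fin n → Finset (Fin m)) (β : ℕ) (T : Finset (Fin m))
    (N' : Finset (Fin n)) : Prop :=
  ((T.card : ℝ) * n / k ≤ (N'.card : ℝ)) ∧ ∀ i ∈ N', β ≤ (A i ∩ T).card

/-- Fully Justified Representation. -/
def FJR (k : ℕ) (A : Fin n → Finset (Fin m)) (W : Finset (Fin m)) : Prop :=
  ∀ β : ℕ, 0 < β → ∀ T : Finset (Fin m), ∀ N' : Finset (Fin n),
    WeaklyCohesive k A β T N' → ∃ i ∈ N', β ≤ (A i ∩ W).card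

/-- The randomized committee `(lam, W)` implements the fractional committee `p`. -/
def Implements {s : ℕ} (lam : Fin s → ℝ) (W : Fin s → Finset (Fin m)) (p : Fin m → ℝ) : Prop :=
  ∀ c, p c = ∑ j, lam j * (if c ∈ W j then 1 else 0)

def A₆ : Fin 4 → Finset (Fin 5) := ![{0}, {0}, {0, 1, 2}, {0, 3, 4}]

theorem strong_GFS_union_impossible :
    ¬ ∃ p : Fin 5 → ℝ, IsFractionalCommittee 4 p ∧
      ∀ S : Finset (Fin 4),
        min ((S.card : ℝ) * 4 / 4) (((S.biUnion A₆).card : ℕ) : ℝ) ≤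
          ∑ c ∈ S.biUnion A₆, p c := by
  rintro ⟨p, ⟨hp, hsum⟩, h⟩
  have union_left : ({0, 1, 2} : Finset (Fin 4)).biUnion A₆ = {0, 1, 2} := by decide
  have union_right : ({0, 1, 3} : Finset (Fin 4)).biUnion A₆ = {0, 3, 4} := by decide
  have h_left := h {0, 1, 2}
  have h_right := h {0, 1, 3}
  have card_voters_left : ({0, 1, 2} : Finset (Fin 4)).card = 3 := by decide
  have card_voters_right : ({0, 1, 3} : Finset (Fin 4)).card = 3 := by decide
  have card_union_left : ({0, 1, 2} : Finset (Fin 5)).card = 3 := by decide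
  have card_union_right : ({0, 3, 4} : Finset (Fin 5)).card = 3 := by decide
  have sum_left : ∑ c ∈ ({0, 1, 2} : Finset (Fin 5)), p c = p 0 + (p 1 + p 2) := by
    rw [sum_insert (by decide), sum_pair (by decide)]
  have sum_right : ∑ c ∈ ({0, 3, 4} : Finset (Fin 5)), p c = p 0 + (p 3 + p 4) := by
    rw [sum_insert (by decide), sum_pair (by decide)]
  rw [union_left, card_voters_left, card_union_left, sum_left] at h_left
  rw [union_right, card_voters_right, card_union_right, sum_right] at h_right
  norm_num at h_left h_right
  rw [Fin.sum_univ_five] at hsum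
  norm_num at hsum
  linarith [(hp 0).2]

end BWCV
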